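/- Let p ∈ (1,2] and φ(t) = t + (1/2)·log(t²), and for τ > 0 define the conjugated operator L_τ v = ∂_t v + i·∂_θ v + τ·(1 + 1/t)·v and the negative-frequency projection P^n_τ = Σ_{k < 0} P_k (acting in the θ-variable). Then there exist t₀ < 0, τ₀ > 0, and a constant C = C(p,t₀) > 0 such that for every τ ≥ τ₀ and every smooth v : ℝ × S¹ → ℂ with compact support contained in (−∞, t₀) × S¹: ‖P^n_τ v‖_{L²(dt dθ)} ≤ C·τ^{−1+1/p}·‖L_τ v‖_{L^p(dt dθ)}. -/

import Mathlib

open MeasureTheory Metric Complex ENNReal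

noncomputable section

/-- Partial derivative in `t` of a function on `ℝ × S¹` (viewed as `ℝ × ℝ`). -/
def dT (v : ℝ × ℝ → ℂ) (q : ℝ × ℝ) : ℂ := deriv (fun s => v (s, q.2)) q.1

/-- Partial derivative in `θ` of a function on `ℝ × S¹` (viewed as `ℝ × ℝ`). -/
def dTh (v : ℝ × ℝ → ℂ) (q : ℝ × ℝ) : ℂ := deriv (fun s => v (q.1, s)) q.2

/-- The region `ℝ × [0, 2π)`, a fundamental domain for `ℝ × S¹`. -/
def stripe : Set (ℝ × ℝ) := Set.univ ×ˢ Set.Ico 0 (2 * Real.pi)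

/-- The conjugated operator `L_τ v = ∂_t v + i ∂_θ v + τ(1 + 1/t) v`. -/
def Ltau (τ : ℝ) (v : ℝ × ℝ → ℂ) (q : ℝ × ℝ) : ℂ :=
  dT v q + Complex.I * dTh v q + ((τ * (1 + 1 / q.1) : ℝ) : ℂ) * v q

/-- The `k`-th Fourier coefficient in `θ`:
`(1/2π) ∫₀^{2π} v(t,θ') e^{-ikθ'} dθ'`. -/
def fcT (v : ℝ × ℝ → ℂ) (k : ℤ) (t : ℝ) : ℂ :=
  (1 / (2 * Real.pi) : ℂ) *
    ∫ θ in Set.Ico (0 : ℝ) (2 * Real.pi), v (t, θ) * Complex.exp (-Complex.I * k * θ)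

/-- The projection `P_k` onto the `k`-th Fourier mode in `θ`. -/
def Pk (v : ℝ × ℝ → ℂ) (k : ℤ) (q : ℝ × ℝ) : ℂ :=
  fcT v k q.1 * Complex.exp (Complex.I * k * q.2)

/-- The negative-frequency projection `P^n_τ = Σ_{k < 0} P_k`. -/
def Pn (v : ℝ × ℝ → ℂ) (q : ℝ × ℝ) : ℂ :=
  ∑' k : ℤ, if k < 0 then Pk v k q else 0

theorem deriv_norm_rpow_add_le {u : ℝ → ℂ} {u' : ℂ} {t p a A : ℝ} (hp : 1 < p)
    (hu : HasDerivAt u u' t) (ha : u t ≠ 0 → A ≤ a) :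
    deriv (fun s => ‖u s‖ ^ p) t + p * A * ‖u t‖ ^ p ≤
      p * (‖u t‖ ^ (p - 1) * ‖u' + a * u t‖) := by
  have hd := (hasFDerivAt_norm_rpow (u t) hp).comp_hasDerivAt t hu
  have hd' : deriv (fun s => ‖u s‖ ^ p) t = p * ‖u t‖ ^ (p - 2) * inner ℝ (u t) u' := by
    rw [show (fun s => ‖u s‖ ^ p) = (fun x : ℂ => ‖x‖ ^ p) ∘ u from rfl, hd.deriv]
    simp
  rw [hd']
  by_cases h0 : u t = 0
  · simp [h0, Real.zero_rpow (by linarith : p ≠ 0)]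
    positivity
  have hpos : 0 < ‖u t‖ := norm_pos_iff.mpr h0
  have h1 : ‖u t‖ ^ (p - 1) = ‖u t‖ ^ (p - 2) * ‖u t‖ := by
    rw [← Real.rpow_add_one hpos.ne']; ring_nf
  have h2 : ‖u t‖ ^ p = ‖u t‖ ^ (p - 2) * ‖u t‖ ^ 2 := by
    rw [← Real.rpow_natCast, ← Real.rpow_add hpos]; norm_num
  have h3 : inner ℝ (u t) (u' + a * u t) = inner ℝ (u t) u' + a * ‖u t‖ ^ 2 := by
    rw [inner_add_right, ← Complex.real_smul, real_inner_smul_right, real_inner_self_eq_norm_sq]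
  have h4 := real_inner_le_norm (u t) (u' + a * u t)
  have h5 : A * ‖u t‖ ^ 2 ≤ a * ‖u t‖ ^ 2 := by gcongr; exact ha h0
  rw [h1, h2]
  have h6 : inner ℝ (u t) u' + A * ‖u t‖ ^ 2 ≤ ‖u t‖ * ‖u' + a * u t‖ := by linarith
  have h7 : 0 ≤ p * ‖u t‖ ^ (p - 2) := by positivity
  nlinarith [mul_le_mul_of_nonneg_left h6 h7]

theorem hasCompactSupport_norm_rpow {u : ℝ → ℂ} {p : ℝ} (hp : 0 < p) (hc : HasCompactSupport u) :
    HasCompactSupport (fun s => ‖u s‖ ^ p) :=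
  hc.comp_left (g := fun x : ℂ => ‖x‖ ^ p) (by simp [hp.ne'])

/-- Energy estimates for `u' + a u = f` with `a` bounded below by `A`. -/
theorem energy_estimates {u : ℝ → ℂ} {a : ℝ → ℝ} {p A : ℝ} (hp : 1 < p) (hA : 0 < A)
    (hu : ContDiff ℝ 1 u) (hc : HasCompactSupport u) (ha : Continuous a)
    (haA : ∀ t, u t ≠ 0 → A ≤ a t) :
    A * ∫ t, ‖u t‖ ^ p ≤ ∫ t, ‖u t‖ ^ (p - 1) * ‖deriv u t + a t * u t‖ ∧
    ∀ t, ‖u t‖ ^ p ≤ p * ∫ t, ‖u t‖ ^ (p - 1) * ‖deriv u t + a t * u t‖ := by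
  have hp0 : 0 < p := by linarith
  have hu' : Continuous (deriv u) := hu.continuous_deriv le_rfl
  set G : ℝ → ℝ := fun s => ‖u s‖ ^ p with hG
  have hGc : ContDiff ℝ 1 G := hu.norm_rpow hp
  have hGs : HasCompactSupport G := hasCompactSupport_norm_rpow hp0 hc
  set H : ℝ → ℝ := fun t => ‖u t‖ ^ (p - 1) * ‖deriv u t + a t * u t‖ with hH
  have hHc : Continuous H := by
    refine (hu.continuous.norm.rpow_const fun _ => Or.inr (by linarith)).mul ?_
    have := hu.continuous
    fun_prop
  have hHs : HasCompactSupport H := (hasCompactSupport_norm_rpow (by linarith) hc).mul_right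
  have hGi : Integrable G := hGc.continuous.integrable_of_hasCompactSupport hGs
  have hHi : Integrable H := hHc.integrable_of_hasCompactSupport hHs
  have hDi : Integrable (deriv G) :=
    (hGc.continuous_deriv le_rfl).integrable_of_hasCompactSupport hGs.deriv
  have hpt : ∀ t, deriv G t + p * A * G t ≤ p * H t := fun t =>
    deriv_norm_rpow_add_le hp (hu.differentiable one_ne_zero t).hasDerivAt (haA t)
  have hD0 : ∫ t, deriv G t = 0 := integral_eq_zero_of_hasDerivAt_of_integrable
    (fun t => (hGc.differentiable one_ne_zero t).hasDerivAt) hDi hGi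
  constructor
  · have := integral_mono (hDi.add (hGi.const_mul (p * A))) (hHi.const_mul p) hpt
    simp only [Pi.add_apply] at this
    rw [integral_add hDi (hGi.const_mul _), integral_const_mul, integral_const_mul, hD0] at this
    nlinarith
  · intro t
    have h1 : G t = ∫ s in Set.Iic t, deriv G s :=
      (hGs.integral_Iic_deriv_eq hGc t).symm
    change G t ≤ _
    rw [h1, ← integral_const_mul]
    refine (setIntegral_mono_on hDi.integrableOn (hHi.const_mul p).integrableOn
      measurableSet_Iic fun s _ => ?_).trans
      (setIntegral_le_integral (hHi.const_mul p) (Filter.Eventually.of_forall fun s => ?_))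
    · have : 0 ≤ p * A * G s := by positivity
      linarith [hpt s]
    · simp only [hH, Pi.zero_apply]; positivity

/-- `L^p → L²` bound for the solution of `u' + a u = f` with `a` bounded below by `A`. -/
theorem integral_sq_le_of_ode {u : ℝ → ℂ} {a : ℝ → ℝ} {p A : ℝ} (hp : 1 < p) (hp2 : p ≤ 2)
    (hA : 0 < A) (hu : ContDiff ℝ 1 u) (hc : HasCompactSupport u) (ha : Continuous a)
    (haA : ∀ t, u t ≠ 0 → A ≤ a t) :
    ∫ t, ‖u t‖ ^ 2 ≤ p ^ ((2 - p) / p) * A ^ (-(3 - 2 / p)) *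
      (∫ t, ‖deriv u t + a t * u t‖ ^ p) ^ (2 / p) := by
  obtain ⟨h1, h2⟩ := energy_estimates hp hA hu hc ha haA
  have hp0 : 0 < p := by linarith
  have hu' : Continuous (deriv u) := hu.continuous_deriv le_rfl
  have huc := hu.continuous
  set f : ℝ → ℂ := fun t => deriv u t + a t * u t with hf
  have hfc : Continuous f := by fun_prop
  have hfs : HasCompactSupport f := hc.deriv.add hc.mul_left
  set J := ∫ t, ‖u t‖ ^ (p - 1) * ‖f t‖ with hJ
  set I := ∫ t, ‖u t‖ ^ p with hI
  set F := ∫ t, ‖f t‖ ^ p with hF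
  have hI0 : 0 ≤ I := integral_nonneg fun t => by positivity
  have hF0 : 0 ≤ F := integral_nonneg fun t => by positivity
  have hJ0 : 0 ≤ J := integral_nonneg fun t => by positivity
  have hq : (p / (p - 1)).HolderConjugate p := (Real.HolderConjugate.conjExponent hp).symm
  have hJI : J ≤ I ^ ((p - 1) / p) * F ^ (1 / p) := by
    have hc1 : Continuous fun t => ‖u t‖ ^ (p - 1) :=
      huc.norm.rpow_const fun _ => Or.inr (by linarith)
    have := integral_mul_le_Lp_mul_Lq_of_nonneg (μ := volume) hq
      (f := fun t => ‖u t‖ ^ (p - 1)) (g := fun t => ‖f t‖)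
      (Filter.Eventually.of_forall fun t => by simp only [Pi.zero_apply]; positivity)
      (Filter.Eventually.of_forall fun t => by simp only [Pi.zero_apply]; positivity)
      (hc1.memLp_of_hasCompactSupport (hasCompactSupport_norm_rpow (by linarith) hc))
      (hfc.norm.memLp_of_hasCompactSupport hfs.norm)
    convert this using 3
    · rw [hI]
      refine integral_congr_ae (Filter.Eventually.of_forall fun t => ?_)
      dsimp only
      rw [← Real.rpow_mul (norm_nonneg _)]
      congr 1; field_simp [show p - 1 ≠ 0 by linarith]
    · rw [one_div_div]
  have hIp : I ≤ A ^ (-p) * F := by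
    rcases hI0.eq_or_lt with h | h
    · rw [← h]; positivity
    have h3 : A * I ^ (1 / p) ≤ F ^ (1 / p) := by
      have h4 : I ^ ((p - 1) / p) * (A * I ^ (1 / p)) ≤ I ^ ((p - 1) / p) * F ^ (1 / p) := by
        calc _ = A * I := by
              rw [mul_left_comm, ← Real.rpow_add h]
              rw [show (p - 1) / p + 1 / p = 1 by field_simp; ring, Real.rpow_one]
          _ ≤ _ := h1.trans hJI
      exact le_of_mul_le_mul_left h4 (by positivity)
    have h5 := Real.rpow_le_rpow (by positivity) h3 hp0.le
    rw [Real.mul_rpow hA.le (by positivity), ← Real.rpow_mul hI0, ← Real.rpow_mul hF0,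
      one_div_mul_cancel hp0.ne', Real.rpow_one, Real.rpow_one] at h5
    rw [Real.rpow_neg hA.le, inv_mul_eq_div, le_div_iff₀ (by positivity)]
    linarith
  have hJF : J ≤ A ^ (-(p - 1)) * F := by
    refine hJI.trans ?_
    calc _ ≤ (A ^ (-p) * F) ^ ((p - 1) / p) * F ^ (1 / p) := by
          gcongr
      _ = _ := by
          rw [Real.mul_rpow (by positivity) hF0, ← Real.rpow_mul hA.le, mul_assoc,
            ← Real.rpow_add_of_nonneg hF0 (div_nonneg (by linarith) hp0.le) (by positivity)]
          rw [show (p - 1) / p + 1 / p = 1 by field_simp; ring, Real.rpow_one]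
          congr 2
          field_simp
  have he : 0 ≤ (2 - p) / p := div_nonneg (by linarith) hp0.le
  have hpt : ∀ t, ‖u t‖ ^ 2 ≤ (p * J) ^ ((2 - p) / p) * ‖u t‖ ^ p := fun t => by
    calc ‖u t‖ ^ 2 = (‖u t‖ ^ p) ^ ((2 - p) / p) * ‖u t‖ ^ p := by
          rw [← Real.rpow_mul (norm_nonneg _), ← Real.rpow_natCast,
            mul_div_cancel₀ _ hp0.ne',
            ← Real.rpow_add_of_nonneg (norm_nonneg _) (by linarith) hp0.le]
          norm_num
      _ ≤ _ := by gcongr; exact h2 t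
  have hGi : Integrable fun t => ‖u t‖ ^ p :=
    (hu.norm_rpow hp).continuous.integrable_of_hasCompactSupport (hasCompactSupport_norm_rpow hp0 hc)
  calc ∫ t, ‖u t‖ ^ 2 ≤ ∫ t, (p * J) ^ ((2 - p) / p) * ‖u t‖ ^ p :=
        integral_mono_of_nonneg (Filter.Eventually.of_forall fun t => by
          simp only [Pi.zero_apply]; positivity) (hGi.const_mul _) (Filter.Eventually.of_forall hpt)
    _ = (p * J) ^ ((2 - p) / p) * I := integral_const_mul _ _
    _ ≤ (p * (A ^ (-(p - 1)) * F)) ^ ((2 - p) / p) * (A ^ (-p) * F) := by gcongr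
    _ = _ := by
        rcases hF0.eq_or_lt with h | h
        · rw [← h, Real.zero_rpow (show 2 / p ≠ 0 by positivity)]; simp
        rw [Real.mul_rpow hp0.le (by positivity), Real.mul_rpow (by positivity) hF0,
          ← Real.rpow_mul hA.le]
        rw [show -(3 - 2 / p) = -(p - 1) * ((2 - p) / p) + -p by field_simp; ring,
          show 2 / p = (2 - p) / p + 1 by field_simp; ring, Real.rpow_add hA, Real.rpow_add_one h.ne']
        ring

theorem fcT_eq_intervalIntegral (v : ℝ × ℝ → ℂ) (k : ℤ) (t : ℝ) :
    fcT v k t = (1 / (2 * Real.pi) : ℂ) *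
      ∫ θ in (0 : ℝ)..(2 * Real.pi), v (t, θ) * Complex.exp (-Complex.I * k * θ) := by
  rw [fcT, intervalIntegral.integral_of_le Real.two_pi_pos.le, integral_Ico_eq_integral_Ioc]

theorem continuous_fcT {v : ℝ × ℝ → ℂ} (hv : Continuous v) (k : ℤ) : Continuous (fcT v k) := by
  rw [show fcT v k = _ from funext (fcT_eq_intervalIntegral v k)]
  refine continuous_const.mul ?_
  refine intervalIntegral.continuous_parametric_intervalIntegral_of_continuous' ?_ _ _
  simp only [Function.uncurry_def]
  fun_prop

theorem hasDerivAt_fst_fderiv {v : ℝ × ℝ → ℂ} (hv : Differentiable ℝ v) (q : ℝ × ℝ) :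
    HasDerivAt (fun s => v (s, q.2)) (fderiv ℝ v q (1, 0)) q.1 := by
  have h : HasDerivAt (fun s : ℝ => (s, q.2)) ((1 : ℝ), (0 : ℝ)) q.1 :=
    (hasDerivAt_id q.1).prodMk (hasDerivAt_const _ _)
  exact (hv q).hasFDerivAt.comp_hasDerivAt q.1 h

theorem hasDerivAt_snd_fderiv {v : ℝ × ℝ → ℂ} (hv : Differentiable ℝ v) (q : ℝ × ℝ) :
    HasDerivAt (fun s => v (q.1, s)) (fderiv ℝ v q (0, 1)) q.2 := by
  have h : HasDerivAt (fun s : ℝ => (q.1, s)) ((0 : ℝ), (1 : ℝ)) q.2 :=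
    (hasDerivAt_const _ _).prodMk (hasDerivAt_id q.2)
  exact (hv q).hasFDerivAt.comp_hasDerivAt q.2 h

theorem hasDerivAt_dT {v : ℝ × ℝ → ℂ} (hv : ContDiff ℝ 1 v) (t θ : ℝ) :
    HasDerivAt (fun s => v (s, θ)) (dT v (t, θ)) t :=
  (hasDerivAt_fst_fderiv (hv.differentiable one_ne_zero) (t, θ)).differentiableAt.hasDerivAt

theorem hasDerivAt_dTh {v : ℝ × ℝ → ℂ} (hv : ContDiff ℝ 1 v) (t θ : ℝ) :
    HasDerivAt (fun s => v (t, s)) (dTh v (t, θ)) θ :=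
  (hasDerivAt_snd_fderiv (hv.differentiable one_ne_zero) (t, θ)).differentiableAt.hasDerivAt

theorem continuous_dT {v : ℝ × ℝ → ℂ} (hv : ContDiff ℝ 1 v) : Continuous (dT v) := by
  rw [show dT v = fun q => fderiv ℝ v q (1, 0) from
    funext fun q => (hasDerivAt_fst_fderiv (hv.differentiable one_ne_zero) q).deriv]
  exact (hv.continuous_fderiv one_ne_zero).clm_apply continuous_const

theorem continuous_dTh {v : ℝ × ℝ → ℂ} (hv : ContDiff ℝ 1 v) : Continuous (dTh v) := by
  rw [show dTh v = fun q => fderiv ℝ v q (0, 1) from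
    funext fun q => (hasDerivAt_snd_fderiv (hv.differentiable one_ne_zero) q).deriv]
  exact (hv.continuous_fderiv one_ne_zero).clm_apply continuous_const

theorem hasDerivAt_fcT {v : ℝ × ℝ → ℂ} (hv : ContDiff ℝ 1 v) (k : ℤ) (t : ℝ) :
    HasDerivAt (fcT v k) (fcT (dT v) k t) t := by
  rw [show fcT v k = _ from funext (fcT_eq_intervalIntegral v k), fcT_eq_intervalIntegral]
  refine HasDerivAt.const_mul _ ?_
  have hc := hv.continuous
  have hd := continuous_dT hv
  obtain ⟨M, hM⟩ := ((isCompact_Icc (a := t - 1) (b := t + 1)).prod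
    (isCompact_Icc (a := (0 : ℝ)) (b := 2 * Real.pi))).exists_bound_of_continuousOn
    (f := fun q : ℝ × ℝ => dT v q * Complex.exp (-Complex.I * k * q.2))
    (by fun_prop)
  refine (intervalIntegral.hasDerivAt_integral_of_dominated_loc_of_deriv_le
    (F := fun t θ => v (t, θ) * Complex.exp (-Complex.I * k * θ))
    (F' := fun t θ => dT v (t, θ) * Complex.exp (-Complex.I * k * θ))
    (bound := fun _ => M) (Icc_mem_nhds (sub_one_lt t) (lt_add_one t))
    (Filter.Eventually.of_forall fun s => Continuous.aestronglyMeasurable (by fun_prop))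
    (Continuous.intervalIntegrable (by fun_prop) _ _)
    (Continuous.aestronglyMeasurable (by fun_prop))
    (Filter.Eventually.of_forall fun θ hθ s hs => hM (s, θ) ⟨hs, ?_⟩)
    intervalIntegrable_const
    (Filter.Eventually.of_forall fun θ _ s _ => (hasDerivAt_dT hv s θ).mul_const _)).2
  rw [Set.uIoc_of_le Real.two_pi_pos.le] at hθ
  exact Set.Ioc_subset_Icc_self hθ

theorem contDiff_fcT {v : ℝ × ℝ → ℂ} (hv : ContDiff ℝ 1 v) (k : ℤ) : ContDiff ℝ 1 (fcT v k) := by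
  rw [contDiff_one_iff_deriv]
  refine ⟨fun t => (hasDerivAt_fcT hv k t).differentiableAt, ?_⟩
  rw [show deriv (fcT v k) = _ from funext fun t => (hasDerivAt_fcT hv k t).deriv]
  exact continuous_fcT (continuous_dT hv) k

theorem fcT_dTh {v : ℝ × ℝ → ℂ} (hv : ContDiff ℝ 1 v)
    (hper : ∀ t θ : ℝ, v (t, θ + 2 * Real.pi) = v (t, θ)) (k : ℤ) (t : ℝ) :
    fcT (dTh v) k t = Complex.I * k * fcT v k t := by
  have hc := hv.continuous
  have hd := continuous_dTh hv
  have he : ∀ θ : ℝ, HasDerivAt (fun θ : ℝ => Complex.exp (-Complex.I * k * θ))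
      (Complex.exp (-Complex.I * k * θ) * (-Complex.I * k)) θ := fun θ => by
    simpa using ((hasDerivAt_id (θ : ℂ)).const_mul (-Complex.I * k)).cexp.comp_ofReal
  have hp : Complex.exp (-Complex.I * k * (2 * Real.pi : ℝ)) = 1 := by
    rw [Complex.exp_eq_one_iff]
    exact ⟨-k, by push_cast; ring⟩
  have h := intervalIntegral.integral_deriv_mul_eq_sub (a := 0) (b := 2 * Real.pi)
    (fun θ _ => hasDerivAt_dTh hv t θ) (fun θ _ => he θ)
    (Continuous.intervalIntegrable (by fun_prop) _ _)
    (Continuous.intervalIntegrable (by fun_prop) _ _)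
  have hv0 : v (t, 2 * Real.pi) = v (t, 0) := by simpa using hper t 0
  rw [hp, hv0, intervalIntegral.integral_add (Continuous.intervalIntegrable (by fun_prop) _ _)
    (Continuous.intervalIntegrable (by fun_prop) _ _)] at h
  simp_rw [← mul_assoc] at h
  simp_rw [intervalIntegral.integral_mul_const] at h
  rw [fcT_eq_intervalIntegral, fcT_eq_intervalIntegral]
  simp only [Complex.ofReal_zero, mul_zero, Complex.exp_zero, sub_self] at h
  linear_combination (1 / (2 * Real.pi) : ℂ) * h

theorem fcT_add {f g : ℝ × ℝ → ℂ} (hf : Continuous f) (hg : Continuous g) (k : ℤ) (t : ℝ) :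
    fcT (fun q => f q + g q) k t = fcT f k t + fcT g k t := by
  simp_rw [fcT_eq_intervalIntegral, add_mul]
  rw [intervalIntegral.integral_add (Continuous.intervalIntegrable (by fun_prop) _ _)
    (Continuous.intervalIntegrable (by fun_prop) _ _), mul_add]

theorem fcT_fst_mul (c : ℝ → ℂ) (f : ℝ × ℝ → ℂ) (k : ℤ) (t : ℝ) :
    fcT (fun q => c q.1 * f q) k t = c t * fcT f k t := by
  simp_rw [fcT_eq_intervalIntegral, mul_assoc, intervalIntegral.integral_const_mul]
  ring

theorem enorm_fcT_le {f : ℝ × ℝ → ℂ} (hf : Continuous f) {p : ℝ} (hp : 1 ≤ p) (k : ℤ) (t : ℝ) :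
    ‖fcT f k t‖ₑ ≤ eLpNorm (fun θ => f (t, θ)) (ENNReal.ofReal p)
      (volume.restrict (Set.Ico 0 (2 * Real.pi))) := by
  set μ := (volume : Measure ℝ).restrict (Set.Ico 0 (2 * Real.pi)) with hμ
  have hpi := Real.two_pi_pos
  have hconst : ‖(1 / (2 * Real.pi) : ℂ)‖ₑ = (ENNReal.ofReal (2 * Real.pi))⁻¹ := by
    rw [← ofReal_norm, ← ENNReal.ofReal_inv_of_pos hpi]
    congr 1
    rw [show (1 / (2 * Real.pi) : ℂ) = (((2 * Real.pi)⁻¹ : ℝ) : ℂ) by push_cast; ring]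
    exact Complex.norm_of_nonneg (by positivity)
  have hexp : ∀ θ : ℝ, ‖Complex.exp (-Complex.I * k * θ)‖ₑ = 1 := fun θ => by
    rw [← ofReal_norm, Complex.norm_exp]
    simp
  have h1 : ‖∫ θ, f (t, θ) * Complex.exp (-Complex.I * k * θ) ∂μ‖ₑ ≤
      eLpNorm (fun θ => f (t, θ)) 1 μ := by
    refine (enorm_integral_le_lintegral_enorm _).trans_eq ?_
    rw [eLpNorm_one_eq_lintegral_enorm]
    simp_rw [enorm_mul, hexp, mul_one]
  have h2 : eLpNorm (fun θ => f (t, θ)) 1 μ ≤ eLpNorm (fun θ => f (t, θ)) (ENNReal.ofReal p) μ *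
      μ Set.univ ^ (1 / (1 : ℝ≥0∞).toReal - 1 / (ENNReal.ofReal p).toReal) :=
    eLpNorm_le_eLpNorm_mul_rpow_measure_univ (by simpa using hp)
      (Continuous.aestronglyMeasurable (by fun_prop))
  have h3 : μ Set.univ ^ (1 / (1 : ℝ≥0∞).toReal - 1 / (ENNReal.ofReal p).toReal) ≤
      ENNReal.ofReal (2 * Real.pi) := by
    rw [hμ, Measure.restrict_apply_univ, Real.volume_Ico, sub_zero, ENNReal.toReal_one,
      ENNReal.toReal_ofReal (by linarith)]
    refine (ENNReal.rpow_le_rpow_of_exponent_le (z := 1) ?_ ?_).trans_eq (ENNReal.rpow_one _)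
    · rw [ENNReal.one_le_ofReal]; linarith [Real.pi_gt_three]
    · have : 0 < 1 / p := by positivity
      linarith
  rw [fcT, enorm_mul, hconst]
  calc _ ≤ (ENNReal.ofReal (2 * Real.pi))⁻¹ *
        (eLpNorm (fun θ => f (t, θ)) (ENNReal.ofReal p) μ * ENNReal.ofReal (2 * Real.pi)) := by
        gcongr
        exact h1.trans (h2.trans (by gcongr))
    _ = _ := by
        rw [mul_comm, mul_assoc, ENNReal.mul_inv_cancel (by simpa using Real.pi_pos)
          ENNReal.ofReal_ne_top, mul_one]

theorem volume_restrict_stripe : (volume : Measure (ℝ × ℝ)).restrict stripe =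
    (volume : Measure ℝ).prod ((volume : Measure ℝ).restrict (Set.Ico 0 (2 * Real.pi))) := by
  rw [stripe, Measure.volume_eq_prod, ← Measure.prod_restrict, Measure.restrict_univ]

theorem lintegral_enorm_fcT_rpow_le {f : ℝ × ℝ → ℂ} (hf : Continuous f) {p : ℝ} (hp : 1 ≤ p)
    (k : ℤ) : ∫⁻ t, ‖fcT f k t‖ₑ ^ p ≤
      eLpNorm f (ENNReal.ofReal p) (volume.restrict stripe) ^ p := by
  have hp0 : 0 < p := by linarith
  have hE : ∀ {α : Type} [MeasurableSpace α] (μ : Measure α) (g : α → ℂ),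
      eLpNorm g (ENNReal.ofReal p) μ ^ p = ∫⁻ x, ‖g x‖ₑ ^ p ∂μ := fun μ g => by
    rw [eLpNorm_eq_lintegral_rpow_enorm_toReal (by simpa using hp0) ENNReal.ofReal_ne_top,
      ENNReal.toReal_ofReal hp0.le, ← ENNReal.rpow_mul, one_div_mul_cancel hp0.ne',
      ENNReal.rpow_one]
  rw [hE, volume_restrict_stripe, lintegral_prod _ (by fun_prop)]
  refine lintegral_mono fun t => ?_
  rw [← hE _ (fun θ => f (t, θ))]
  exact ENNReal.rpow_le_rpow (enorm_fcT_le hf hp k t) hp0.le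

theorem integral_exp_int (m : ℤ) :
    ∫ θ in (0 : ℝ)..(2 * Real.pi), Complex.exp (Complex.I * m * θ) =
      if m = 0 then (2 * Real.pi : ℂ) else 0 := by
  split_ifs with h
  · simp [h]
  · rw [integral_exp_mul_complex (by simp [h])]
    have : Complex.exp (Complex.I * m * (2 * Real.pi : ℝ)) = 1 := by
      rw [Complex.exp_eq_one_iff]
      exact ⟨m, by push_cast; ring⟩
    rw [this]; simp

theorem integral_norm_sq_trigPoly {ι : Type*} (S : Finset ι) (κ : ι → ℤ)
    (hκ : Function.Injective κ) (c : ι → ℂ) :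
    ∫ θ in (0 : ℝ)..(2 * Real.pi), ‖∑ i ∈ S, c i * Complex.exp (Complex.I * κ i * θ)‖ ^ 2 =
      2 * Real.pi * ∑ i ∈ S, ‖c i‖ ^ 2 := by
  classical
  have hpt : ∀ θ : ℝ, ((‖∑ i ∈ S, c i * Complex.exp (Complex.I * κ i * θ)‖ ^ 2 : ℝ) : ℂ) =
      ∑ i ∈ S, ∑ j ∈ S, c i * (starRingEnd ℂ) (c j) *
        Complex.exp (Complex.I * ((κ i - κ j : ℤ) : ℂ) * θ) := fun θ => by
    rw [Complex.ofReal_pow, ← Complex.mul_conj', map_sum, Finset.sum_mul_sum]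
    refine Finset.sum_congr rfl fun i _ => Finset.sum_congr rfl fun j _ => ?_
    rw [map_mul, ← Complex.exp_conj, mul_mul_mul_comm, ← Complex.exp_add]
    congr 2
    simp only [map_mul, Complex.conj_I, Complex.conj_ofReal, map_intCast]
    push_cast; ring
  apply Complex.ofReal_injective
  rw [← intervalIntegral.integral_ofReal]
  simp_rw [hpt]
  rw [intervalIntegral.integral_finsetSum
    fun i _ => Continuous.intervalIntegrable (by fun_prop) _ _]
  push_cast
  rw [Finset.mul_sum]
  refine Finset.sum_congr rfl fun i hi => ?_
  rw [intervalIntegral.integral_finsetSum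
    fun j _ => Continuous.intervalIntegrable (by fun_prop) _ _]
  simp_rw [← Int.cast_sub, intervalIntegral.integral_const_mul, integral_exp_int, sub_eq_zero,
    hκ.eq_iff]
  simp [hi, Complex.mul_conj']
  ring

theorem lintegral_enorm_sq_trigPoly {ι : Type*} (S : Finset ι) (κ : ι → ℤ)
    (hκ : Function.Injective κ) (c : ι → ℂ) :
    ∫⁻ θ in Set.Ico 0 (2 * Real.pi),
        ‖∑ i ∈ S, c i * Complex.exp (Complex.I * κ i * (θ : ℝ))‖ₑ ^ 2 =
      ENNReal.ofReal (2 * Real.pi) * ∑ i ∈ S, ‖c i‖ₑ ^ 2 := by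
  have h := integral_norm_sq_trigPoly S κ hκ c
  rw [intervalIntegral.integral_of_le Real.two_pi_pos.le, ← integral_Ico_eq_integral_Ioc] at h
  have hint : IntegrableOn
      (fun θ : ℝ => ‖∑ i ∈ S, c i * Complex.exp (Complex.I * κ i * θ)‖ ^ 2)
      (Set.Ico 0 (2 * Real.pi)) :=
    (Continuous.integrableOn_Icc (by fun_prop)).mono_set Set.Ico_subset_Icc_self
  have h2 := ofReal_integral_eq_lintegral_ofReal hint
    (Filter.Eventually.of_forall fun θ => by simp only [Pi.zero_apply]; positivity)
  simp_rw [ENNReal.ofReal_pow (norm_nonneg _), ofReal_norm] at h2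
  rw [← h2, h, ENNReal.ofReal_mul Real.two_pi_pos.le,
    ENNReal.ofReal_sum_of_nonneg fun i _ => by positivity]
  simp_rw [ENNReal.ofReal_pow (norm_nonneg _), ofReal_norm]

theorem lintegral_stripe_sum_Pk {v : ℝ × ℝ → ℂ} (hv : Continuous v) {ι : Type*} (S : Finset ι)
    (κ : ι → ℤ) (hκ : Function.Injective κ) :
    ∫⁻ q in stripe, ‖∑ i ∈ S, Pk v (κ i) q‖ₑ ^ 2 =
      ENNReal.ofReal (2 * Real.pi) * ∑ i ∈ S, ∫⁻ t, ‖fcT v (κ i) t‖ₑ ^ 2 := by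
  have hc := fun k => continuous_fcT hv k
  simp_rw [Pk]
  rw [volume_restrict_stripe, lintegral_prod _ (by fun_prop)]
  simp_rw [lintegral_enorm_sq_trigPoly S κ hκ]
  rw [lintegral_const_mul _ (by fun_prop), lintegral_finsetSum _ (by fun_prop)]

theorem Pn_eq_tsum_nat (v : ℝ × ℝ → ℂ) (q : ℝ × ℝ) :
    Pn v q = ∑' n : ℕ, Pk v (-(n + 1 : ℤ)) q := by
  have hg : Function.Injective fun n : ℕ => -(n + 1 : ℤ) := fun m n h => by
    simp only at h; omega
  rw [Pn, ← hg.tsum_eq]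
  · exact tsum_congr fun n => if_pos (by omega)
  · intro k hk
    have : k < 0 := by
      by_contra h
      simp [h] at hk
    exact ⟨(-k - 1).toNat, by simp only; omega⟩

theorem enorm_Pn_sq_le (v : ℝ × ℝ → ℂ) (q : ℝ × ℝ) :
    ‖Pn v q‖ₑ ^ 2 ≤ Filter.liminf
      (fun N => ‖∑ n ∈ Finset.range N, Pk v (-(n + 1 : ℤ)) q‖ₑ ^ 2) Filter.atTop := by
  rw [Pn_eq_tsum_nat]
  by_cases h : Summable fun n : ℕ => Pk v (-(n + 1 : ℤ)) q
  · exact ((ENNReal.continuous_pow 2).tendsto _ |>.comp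
      h.hasSum.tendsto_sum_nat.enorm).liminf_eq.ge
  · rw [tsum_eq_zero_of_not_summable h]
    simp

theorem lintegral_Pn_sq_le {v : ℝ × ℝ → ℂ} (hv : Continuous v) {B : ℝ≥0∞}
    (hB : ∀ N : ℕ, ENNReal.ofReal (2 * Real.pi) *
      ∑ n ∈ Finset.range N, ∫⁻ t, ‖fcT v (-(n + 1 : ℤ)) t‖ₑ ^ 2 ≤ B) :
    ∫⁻ q in stripe, ‖Pn v q‖ₑ ^ 2 ≤ B := by
  have hg : Function.Injective fun n : ℕ => -(n + 1 : ℤ) := fun m n h => by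
    simp only at h; omega
  have hc := fun k => continuous_fcT hv k
  refine (lintegral_mono fun q => enorm_Pn_sq_le v q).trans ?_
  refine (lintegral_liminf_le fun N => ?_).trans ?_
  · simp_rw [Pk]
    fun_prop
  · simp_rw [lintegral_stripe_sum_Pk hv _ (fun n : ℕ => -(n + 1 : ℤ)) hg]
    exact (Filter.liminf_le_liminf (Filter.Eventually.of_forall hB)).trans_eq
      (Filter.liminf_const B)

theorem sum_rpow_neg_le {x s : ℝ} (hx : 0 < x) (hs : 1 < s) (N : ℕ) :
    ∑ n ∈ Finset.range N, (x + (n + 1 : ℕ)) ^ (-s) ≤ x ^ (1 - s) / (s - 1) := by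
  have hanti : AntitoneOn (fun y : ℝ => y ^ (-s)) (Set.Icc x (x + N)) := fun y hy z _ hyz =>
    Real.rpow_le_rpow_of_nonpos (hx.trans_le hy.1) hyz (by linarith)
  refine hanti.sum_le_integral.trans ?_
  have hmem : (0 : ℝ) ∉ Set.uIcc x (x + N) := by
    rw [Set.uIcc_of_le (by simp)]
    exact fun h => hx.not_ge h.1
  rw [integral_rpow (Or.inr ⟨by linarith, hmem⟩), ← neg_div_neg_eq]
  have h0 : 0 ≤ (x + N) ^ (-s + 1) := by positivity
  rw [show -(-s + 1) = s - 1 by ring, show 1 - s = -s + 1 by ring]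
  gcongr
  linarith

theorem lintegral_enorm_sq_le_of_ode {u : ℝ → ℂ} {a : ℝ → ℝ} {p A : ℝ} (hp : 1 < p) (hp2 : p ≤ 2)
    (hA : 0 < A) (hu : ContDiff ℝ 1 u) (hc : HasCompactSupport u) (ha : Continuous a)
    (haA : ∀ t, u t ≠ 0 → A ≤ a t) :
    ∫⁻ t, ‖u t‖ₑ ^ 2 ≤ ENNReal.ofReal (p ^ ((2 - p) / p) * A ^ (-(3 - 2 / p))) *
      (∫⁻ t, ‖deriv u t + a t * u t‖ₑ ^ p) ^ (2 / p) := by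
  have hp0 : 0 < p := by linarith
  have hcont : Continuous fun t => deriv u t + a t * u t := by
    have := hu.continuous_deriv le_rfl
    have := hu.continuous
    fun_prop
  have hfs : HasCompactSupport fun t => deriv u t + a t * u t := hc.deriv.add hc.mul_left
  have hs1 : HasCompactSupport fun t => ‖u t‖ ^ 2 :=
    hc.norm.comp_left (g := fun x : ℝ => x ^ 2) (by simp)
  have hi1 : Integrable fun t => ‖u t‖ ^ 2 :=
    (hu.continuous.norm.pow 2).integrable_of_hasCompactSupport hs1
  have hi2 : Integrable fun t => ‖deriv u t + a t * u t‖ ^ p :=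
    (hcont.norm.rpow_const fun _ => Or.inr hp0.le).integrable_of_hasCompactSupport
      (hasCompactSupport_norm_rpow hp0 hfs)
  have h1 := ofReal_integral_eq_lintegral_ofReal hi1
    (Filter.Eventually.of_forall fun t => by simp only [Pi.zero_apply]; positivity)
  have h2 := ofReal_integral_eq_lintegral_ofReal hi2
    (Filter.Eventually.of_forall fun t => by simp only [Pi.zero_apply]; positivity)
  simp_rw [ENNReal.ofReal_pow (norm_nonneg _), ofReal_norm] at h1
  simp_rw [← ENNReal.ofReal_rpow_of_nonneg (norm_nonneg _) hp0.le, ofReal_norm] at h2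
  rw [← h1, ← h2, ENNReal.ofReal_rpow_of_nonneg
    (integral_nonneg fun t => by positivity) (by positivity), ← ENNReal.ofReal_mul (by positivity)]
  exact ENNReal.ofReal_le_ofReal (integral_sq_le_of_ode hp hp2 hA hu hc ha haA)

theorem Ltau_eq_of_support {τ t₀ : ℝ} {v : ℝ × ℝ → ℂ}
    (hsupp : ∀ q : ℝ × ℝ, v q ≠ 0 → q.1 < t₀) :
    Ltau τ v = fun q => (dT v q + Complex.I * dTh v q) +
      ((τ * (1 + 1 / min q.1 t₀) : ℝ) : ℂ) * v q := by
  funext q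
  rw [Ltau]
  by_cases h : v q = 0
  · simp [h]
  · rw [min_eq_left (hsupp q h).le]

theorem continuous_potential {τ t₀ : ℝ} (ht₀ : t₀ < 0) :
    Continuous fun t : ℝ => τ * (1 + 1 / min t t₀) := by
  refine continuous_const.mul (continuous_const.add (continuous_const.div (by fun_prop) ?_))
  exact fun t => ((min_le_right t t₀).trans_lt ht₀).ne

theorem continuous_Ltau {τ t₀ : ℝ} (ht₀ : t₀ < 0) {v : ℝ × ℝ → ℂ} (hv : ContDiff ℝ 1 v)
    (hsupp : ∀ q : ℝ × ℝ, v q ≠ 0 → q.1 < t₀) : Continuous (Ltau τ v) := by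
  rw [Ltau_eq_of_support hsupp]
  have h1 := continuous_dT hv
  have h2 := continuous_dTh hv
  have h3 := hv.continuous
  have h4 := (continuous_potential (τ := τ) ht₀).comp (continuous_fst (X := ℝ) (Y := ℝ))
  exact (h1.add (continuous_const.mul h2)).add ((Complex.continuous_ofReal.comp h4).mul h3)

theorem fcT_Ltau {τ t₀ : ℝ} (ht₀ : t₀ < 0) {v : ℝ × ℝ → ℂ} (hv : ContDiff ℝ 1 v)
    (hper : ∀ t θ : ℝ, v (t, θ + 2 * Real.pi) = v (t, θ))
    (hsupp : ∀ q : ℝ × ℝ, v q ≠ 0 → q.1 < t₀) (k : ℤ) (t : ℝ) :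
    fcT (Ltau τ v) k t =
      deriv (fcT v k) t + ((-k + τ * (1 + 1 / min t t₀) : ℝ) : ℂ) * fcT v k t := by
  have h1 := continuous_dT hv
  have h2 : Continuous fun q => Complex.I * dTh v q := continuous_const.mul (continuous_dTh hv)
  have h3 : Continuous fun q => dT v q + Complex.I * dTh v q := h1.add h2
  have h4 : Continuous fun q : ℝ × ℝ => ((τ * (1 + 1 / min q.1 t₀) : ℝ) : ℂ) * v q :=
    (Complex.continuous_ofReal.comp
      ((continuous_potential ht₀).comp continuous_fst)).mul hv.continuous
  rw [Ltau_eq_of_support hsupp, fcT_add h3 h4, fcT_add h1 h2, fcT_fst_mul (fun _ => Complex.I),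
    fcT_fst_mul (fun t => ((τ * (1 + 1 / min t t₀) : ℝ) : ℂ)), fcT_dTh hv hper,
    (hasDerivAt_fcT hv k t).deriv]
  push_cast
  linear_combination (k : ℂ) * fcT v k t * Complex.I_mul_I

/-- The `L^p → L²` bound for a single negative Fourier mode. -/
theorem lintegral_fcT_sq_le {p τ : ℝ} (hp : 1 < p) (hp2 : p ≤ 2) (hτ : 0 < τ) {v : ℝ × ℝ → ℂ}
    (hv : ContDiff ℝ 1 v) (hper : ∀ t θ : ℝ, v (t, θ + 2 * Real.pi) = v (t, θ)) {a : ℝ}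
    (hsupp : ∀ q : ℝ × ℝ, v q ≠ 0 → a < q.1 ∧ q.1 < -2) (n : ℕ) :
    ∫⁻ t, ‖fcT v (-(n + 1 : ℤ)) t‖ₑ ^ 2 ≤
      ENNReal.ofReal (p ^ ((2 - p) / p) * (τ / 2 + (n + 1 : ℕ)) ^ (-(3 - 2 / p))) *
        eLpNorm (Ltau τ v) (ENNReal.ofReal p) (volume.restrict stripe) ^ 2 := by
  have hp0 : 0 < p := by linarith
  have h2 : (-2 : ℝ) < 0 := by norm_num
  set k : ℤ := -(n + 1 : ℤ) with hk
  have hc : HasCompactSupport (fcT v k) := by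
    refine HasCompactSupport.intro (isCompact_Icc (a := a) (b := -2)) fun t ht => ?_
    have h0 : ∀ θ : ℝ, v (t, θ) = 0 := fun θ => by
      by_contra h
      exact ht ⟨(hsupp _ h).1.le, (hsupp _ h).2.le⟩
    simp [fcT, h0]
  have hbd : ∀ t : ℝ, τ / 2 + (n + 1 : ℕ) ≤ -k + τ * (1 + 1 / min t (-2)) := fun t => by
    have hm : min t (-2) ≤ -2 := min_le_right _ _
    have : -(1 / 2) ≤ 1 / min t (-2) := by
      rw [le_div_iff_of_neg (by linarith)]
      linarith
    rw [hk]
    push_cast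
    nlinarith
  have h : ∫⁻ t, ‖fcT v k t‖ₑ ^ 2 ≤
      ENNReal.ofReal (p ^ ((2 - p) / p) * (τ / 2 + (n + 1 : ℕ)) ^ (-(3 - 2 / p))) *
        (∫⁻ t, ‖fcT (Ltau τ v) k t‖ₑ ^ p) ^ (2 / p) := by
    simp_rw [fcT_Ltau h2 hv hper (fun q hq => (hsupp q hq).2)]
    exact lintegral_enorm_sq_le_of_ode hp hp2 (by positivity) (contDiff_fcT hv k) hc
      (continuous_const.add (continuous_potential h2)) fun t _ => hbd t
  refine h.trans ?_
  gcongr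
  refine (ENNReal.rpow_le_rpow (lintegral_enorm_fcT_rpow_le
    (continuous_Ltau h2 hv fun q hq => (hsupp q hq).2) hp.le k) (by positivity)).trans_eq ?_
  rw [← ENNReal.rpow_mul, mul_div_cancel₀ _ hp0.ne', ENNReal.rpow_two]

/-- The bound for the negative-frequency part in the Carleman estimate. -/
theorem statement16 (p : ℝ) (hp1 : 1 < p) (hp2 : p ≤ 2) :
    ∃ t₀ < (0 : ℝ), ∃ τ₀ > (0 : ℝ), ∃ C > (0 : ℝ),
      ∀ τ : ℝ, τ₀ ≤ τ →
      ∀ v : ℝ × ℝ → ℂ, ContDiff ℝ (⊤ : ℕ∞) v →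
        (∀ t θ : ℝ, v (t, θ + 2 * Real.pi) = v (t, θ)) →
        (∃ a : ℝ, ∀ q : ℝ × ℝ, v q ≠ 0 → a < q.1 ∧ q.1 < t₀) →
        eLpNorm (Pn v) 2 (volume.restrict stripe) ≤
          ENNReal.ofReal (C * τ ^ (-1 + 1 / p)) *
            eLpNorm (Ltau τ v) (ENNReal.ofReal p) (volume.restrict stripe) := by
  have hp0 : 0 < p := by linarith
  have hs : 1 < 3 - 2 / p := by
    have : 2 / p < 2 := by rw [div_lt_iff₀ hp0]; linarith
    linarith
  set s := 3 - 2 / p with hs_def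
  set D : ℝ := 2 * Real.pi * (p ^ ((2 - p) / p) * ((1 / 2) ^ (1 - s) / (s - 1))) with hD
  have hD0 : 0 < D := by
    have : 0 < s - 1 := by linarith
    positivity
  refine ⟨-2, by norm_num, 1, one_pos, D ^ (1 / 2 : ℝ), by positivity, ?_⟩
  rintro τ hτ v hv hper ⟨a, hsupp⟩
  have hτ0 : 0 < τ := by linarith
  have hv1 : ContDiff ℝ 1 v := hv.of_le (by norm_cast)
  set E := eLpNorm (Ltau τ v) (ENNReal.ofReal p) (volume.restrict stripe) with hE
  have key : ∫⁻ q in stripe, ‖Pn v q‖ₑ ^ 2 ≤ ENNReal.ofReal (D * τ ^ (1 - s)) * E ^ 2 := by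
    refine lintegral_Pn_sq_le hv.continuous fun N => ?_
    have hsum := sum_rpow_neg_le (x := τ / 2) (by positivity) hs N
    calc _ ≤ ENNReal.ofReal (2 * Real.pi) * ∑ n ∈ Finset.range N,
          ENNReal.ofReal (p ^ ((2 - p) / p) * (τ / 2 + (n + 1 : ℕ)) ^ (-s)) * E ^ 2 := by
          gcongr with n _
          exact lintegral_fcT_sq_le hp1 hp2 hτ0 hv1 hper hsupp n
      _ = ENNReal.ofReal (2 * Real.pi * (p ^ ((2 - p) / p) *
          ∑ n ∈ Finset.range N, (τ / 2 + (n + 1 : ℕ)) ^ (-s))) * E ^ 2 := by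
          rw [← Finset.sum_mul, ← mul_assoc, ← ENNReal.ofReal_sum_of_nonneg
            fun n _ => by positivity, ← ENNReal.ofReal_mul Real.two_pi_pos.le, ← Finset.mul_sum]
      _ ≤ _ := by
          gcongr ENNReal.ofReal ?_ * _
          rw [hD, mul_assoc (2 * Real.pi), mul_assoc (p ^ _)]
          gcongr
          refine hsum.trans_eq ?_
          rw [div_eq_mul_one_div τ 2, mul_comm τ, Real.mul_rpow (by norm_num) hτ0.le]
          ring
  rw [eLpNorm_eq_lintegral_rpow_enorm_toReal two_ne_zero ENNReal.ofNat_ne_top]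
  simp only [ENNReal.toReal_ofNat, ENNReal.rpow_two]
  calc _ ≤ (ENNReal.ofReal (D * τ ^ (1 - s)) * E ^ 2) ^ (1 / 2 : ℝ) :=
        ENNReal.rpow_le_rpow key (by norm_num)
    _ = _ := by
        rw [ENNReal.mul_rpow_of_nonneg _ _ (by norm_num), ← ENNReal.rpow_two, ← ENNReal.rpow_mul,
          ENNReal.ofReal_rpow_of_nonneg (by positivity) (by norm_num),
          Real.mul_rpow hD0.le (by positivity), ← Real.rpow_mul hτ0.le, hs_def]
        rw [show (1 - (3 - 2 / p)) * (1 / 2) = -1 + 1 / p by ring]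
        norm_num

end
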